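/- For every ν ∈ ℝ, the function x ↦ x^ν K_ν(x) is strictly decreasing on (0, ∞); in particular, for all 0 < x ≤ z, K_ν(z)/K_ν(x) ≤ (x/z)^ν. -/

import Mathlib

/-- The Macdonald function (modified Bessel function of the second kind):
`K_ν(x) = (x^ν / 2^(ν+1)) ∫_0^∞ exp(−t − x²/(4t)) t^(−ν−1) dt` for `x > 0`. -/
noncomputable def besselK (ν x : ℝ) : ℝ :=
  x ^ ν / 2 ^ (ν + 1) *
    ∫ t in Set.Ioi (0 : ℝ), Real.exp (-t - x ^ 2 / (4 * t)) * t ^ (-ν - 1)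

open MeasureTheory Set

theorem integrableOn_exp_neg_sub_div_mul_rpow {a : ℝ} (ha : 0 < a) (s : ℝ) :
    IntegrableOn (fun t : ℝ => Real.exp (-t - a / t) * t ^ s) (Ioi 0) := by
  obtain ⟨n, hn⟩ := exists_nat_gt (-s - 1)
  have hG : IntegrableOn (fun t : ℝ => n.factorial / a ^ n *
      (Real.exp (-t) * t ^ (s + n + 1 - 1))) (Ioi 0) :=
    (Real.GammaIntegral_convergent (by linarith)).const_mul _
  refine hG.mono' (ContinuousOn.aestronglyMeasurable (fun t ht => ?_) measurableSet_Ioi) ?_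
  · have ht : t ≠ 0 := (mem_Ioi.mp ht).ne'
    exact ContinuousAt.continuousWithinAt (by fun_prop (disch := simp [ht]))
  · refine (ae_restrict_iff' measurableSet_Ioi).2 (.of_forall fun t ht => ?_)
    have ht : 0 < t := ht
    have hpow := Real.pow_div_factorial_le_exp (a / t) (by positivity) n
    have hexp : Real.exp (-(a / t)) ≤ n.factorial / a ^ n * t ^ n := by
      rw [Real.exp_neg]
      refine (inv_anti₀ (by positivity) hpow).trans_eq ?_
      rw [div_pow]
      field_simp
    rw [Real.norm_of_nonneg (by positivity), sub_eq_add_neg, Real.exp_add,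
      add_sub_cancel_right, Real.rpow_add ht, Real.rpow_natCast]
    calc Real.exp (-t) * Real.exp (-(a / t)) * t ^ s
        ≤ Real.exp (-t) * (n.factorial / a ^ n * t ^ n) * t ^ s := by gcongr
      _ = _ := by ring

theorem setIntegral_Ioi_lt_of_forall_lt {f g : ℝ → ℝ} {a : ℝ} (hf : IntegrableOn f (Ioi a))
    (hg : IntegrableOn g (Ioi a)) (h : ∀ t ∈ Ioi a, f t < g t) :
    ∫ t in Ioi a, f t < ∫ t in Ioi a, g t := by
  have hsub : Ioi a ⊆ Function.support fun t => g t - f t := fun t ht => (sub_pos.2 (h t ht)).ne'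
  rw [← sub_pos, ← integral_sub hg hf, setIntegral_pos_iff_support_of_nonneg_ae
    ((ae_restrict_iff' measurableSet_Ioi).2 (.of_forall fun t ht => sub_nonneg.2 (h t ht).le))
    (hg.sub hf), inter_eq_self_of_subset_right hsub]
  simp

theorem integral_exp_neg_sub_div_mul_rpow_pos {a : ℝ} (ha : 0 < a) (s : ℝ) :
    0 < ∫ t in Ioi (0 : ℝ), Real.exp (-t - a / t) * t ^ s := by
  simpa using setIntegral_Ioi_lt_of_forall_lt (f := fun _ => 0) integrableOn_zero
    (integrableOn_exp_neg_sub_div_mul_rpow ha s)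
    fun t ht => mul_pos (Real.exp_pos _) (Real.rpow_pos_of_pos ht s)

theorem strictAntiOn_integral_exp_neg_sub_div_mul_rpow (s : ℝ) :
    StrictAntiOn (fun a : ℝ => ∫ t in Ioi (0 : ℝ), Real.exp (-t - a / t) * t ^ s) (Ioi 0) := by
  intro a ha b hb hab
  refine setIntegral_Ioi_lt_of_forall_lt (integrableOn_exp_neg_sub_div_mul_rpow hb s)
    (integrableOn_exp_neg_sub_div_mul_rpow ha s) fun t ht => ?_
  have ht : 0 < t := ht
  gcongr

/-- The substitution `t ↦ a / t`. -/
theorem rpow_mul_integral_exp_neg_sub_div_mul_rpow {a : ℝ} (ha : 0 < a) (ν : ℝ) :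
    a ^ ν * ∫ t in Ioi (0 : ℝ), Real.exp (-t - a / t) * t ^ (-ν - 1) =
      ∫ t in Ioi (0 : ℝ), Real.exp (-t - a / t) * t ^ (ν - 1) := by
  set g : ℝ → ℝ := fun t => Real.exp (-t - a / t) * t ^ (-ν - 1) with hg
  have hscale := integral_comp_mul_left_Ioi g 0 ha
  have hinv := integral_comp_rpow_Ioi (fun t => g (a * t)) (p := -1) (by norm_num)
  rw [mul_zero, smul_eq_mul, ← hinv] at hscale
  rw [← mul_right_inj' (inv_ne_zero ha.ne'), mul_left_comm, ← hscale, ← integral_const_mul,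
    ← integral_const_mul]
  refine setIntegral_congr_fun measurableSet_Ioi fun t ht => ?_
  have ht : 0 < t := ht
  have hexp : -(a * t⁻¹) - a / (a * t⁻¹) = -t - a / t := by
    field_simp
    ring
  simp only [hg, smul_eq_mul, Real.rpow_neg_one, hexp]
  rw [Real.mul_rpow ha.le (by positivity), Real.inv_rpow ht.le, ← Real.rpow_neg ht.le,
    show ν - 1 = (-1 - 1) + -(-ν - 1) by ring, Real.rpow_add ht,
    show -ν - 1 = -ν + -1 by ring, Real.rpow_add ha, Real.rpow_neg ha.le ν, Real.rpow_neg_one]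
  have : a ^ ν ≠ 0 := by positivity
  norm_num
  field_simp

theorem besselK_pos (ν : ℝ) {x : ℝ} (hx : 0 < x) : 0 < besselK ν x := by
  have h := integral_exp_neg_sub_div_mul_rpow_pos (a := x ^ 2 / 4) (by positivity) (-ν - 1)
  simp only [div_div] at h
  unfold besselK
  positivity

theorem rpow_mul_besselK (ν : ℝ) {x : ℝ} (hx : 0 < x) :
    x ^ ν * besselK ν x = 2 ^ (ν - 1) *
      ∫ t in Ioi (0 : ℝ), Real.exp (-t - x ^ 2 / 4 / t) * t ^ (ν - 1) := by
  have hpow : (x ^ 2 / 4) ^ ν = x ^ ν * x ^ ν / (2 ^ ν * 2 ^ ν) := by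
    rw [show x ^ 2 / 4 = x / 2 * (x / 2) by ring, Real.mul_rpow (by positivity) (by positivity),
      Real.div_rpow hx.le zero_le_two]
    ring
  rw [← rpow_mul_integral_exp_neg_sub_div_mul_rpow (by positivity), hpow, besselK,
    Real.rpow_add two_pos, Real.rpow_sub two_pos, Real.rpow_one]
  simp only [div_div]
  generalize ∫ t in Ioi (0 : ℝ), Real.exp (-t - x ^ 2 / (4 * t)) * t ^ (-ν - 1) = I
  field_simp

/-- For every `ν ∈ ℝ`, `x ↦ x^ν K_ν(x)` is strictly decreasing on `(0, ∞)`;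
in particular, for all `0 < x ≤ z`, `K_ν(z)/K_ν(x) ≤ (x/z)^ν`. -/
theorem hatK_strictAnti (ν : ℝ) :
    StrictAntiOn (fun x : ℝ => x ^ ν * besselK ν x) (Set.Ioi 0) ∧
    ∀ x z : ℝ, 0 < x → x ≤ z → besselK ν z / besselK ν x ≤ (x / z) ^ ν := by
  have hanti : StrictAntiOn (fun x : ℝ => x ^ ν * besselK ν x) (Set.Ioi 0) := by
    intro x hx z hz hxz
    have hx : 0 < x := hx
    have hz : 0 < z := hz
    simp only [rpow_mul_besselK ν hx, rpow_mul_besselK ν hz]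
    refine mul_lt_mul_of_pos_left (strictAntiOn_integral_exp_neg_sub_div_mul_rpow (ν - 1)
      (mem_Ioi.2 (by positivity)) (mem_Ioi.2 (by positivity)) ?_) (by positivity)
    gcongr
  refine ⟨hanti, fun x z hx hxz => ?_⟩
  have hz : 0 < z := hx.trans_le hxz
  rw [Real.div_rpow hx.le hz.le, div_le_div_iff₀ (besselK_pos ν hx) (by positivity), mul_comm]
  exact hanti.antitoneOn hx hz hxz
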